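/- arXiv:0806.4487 — 2 statements merged into one kernel-verified Lean document; each statement's English description precedes it below -/
import Mathlib

section
/- Let P and P' be partial fields such that P' is an induced sub-partial field of P, and let A be a P-matrix all of whose entries lie in P'. Then A is a P'-matrix. -/
/-- The determinant of a matrix with entries in a subring lies in that subring. -/
theorem Matrix.det_mem_of_subring {R n : Type*} [CommRing R] [Fintype n] [DecidableEq n]
    (S : Subring R) {M : Matrix n n R} (hM : ∀ i j, M i j ∈ S) : M.det ∈ S := by
  rw [Matrix.det_apply]
  exact sum_mem fun σ _ => zsmul_mem (prod_mem fun i _ => hM (σ i) i) _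


open scoped Classical

/-- A partial field `(R, G)`: a commutative ring `R` together with a subgroup `G`
of its unit group containing `-1`. -/
structure PartialField (R : Type) [CommRing R] : Type where
  units : Subgroup Rˣ
  neg_one_mem : (-1 : Rˣ) ∈ units

namespace PartialField

variable {R : Type} [CommRing R]

/-- The set of elements of a partial field: `G ∪ {0}`, viewed inside the ring `R`. -/
def carrier (P : PartialField R) : Set R :=
  {x | x = 0 ∨ ∃ u : Rˣ, u ∈ P.units ∧ (u : R) = x}

/-- The partial field `(R, ⟨S ∪ {-1}⟩)` generated by a set `S` of (invertible)
elements of `R`. -/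
def ofSet (S : Set R) : PartialField R :=
  ⟨Subgroup.closure ({-1} ∪ {u : Rˣ | (u : R) ∈ S}),
    Subgroup.subset_closure (Set.mem_union_left _ rfl)⟩

/-- Every field is a partial field `(F, F*)`. -/
def ofField (F : Type) [Field F] : PartialField F := ⟨⊤, trivial⟩

/-- `P'` is an *induced* sub-partial field of `P`: its group is the intersection of
the group of `P` with a subring of `R`. -/
def IsInducedSub (P' P : PartialField R) : Prop :=
  ∃ S : Subring R, ∀ u : Rˣ, u ∈ P'.units ↔ (u ∈ P.units ∧ (u : R) ∈ S)

/-- The fundamental elements of `P`: those `p ∈ P` with `1 - p ∈ P`. -/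
def funSet (P : PartialField R) : Set R :=
  {p | p ∈ P.carrier ∧ 1 - p ∈ P.carrier}

end PartialField

section Matrices

variable {R : Type} [CommRing R]

/-- A `P`-matrix: every square submatrix has determinant in `P`. -/
def IsPMatrix (P : PartialField R) {X Y : Type} (A : Matrix X Y R) : Prop :=
  ∀ (k : ℕ) (f : Fin k → X) (g : Fin k → Y),
    Function.Injective f → Function.Injective g → (A.submatrix f g).det ∈ P.carrier

/-- The pivot of `A` over the entry `(x, y)`, in positional form: the new row labelled `y`
is placed at position `x`, and the new column labelled `x` at position `y`. -/
noncomputable def pivotMat {X Y : Type} (A : Matrix X Y R) (x : X) (y : Y) :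
    Matrix X Y R :=
  Matrix.of fun u v =>
    if u = x then
      (if v = y then Ring.inverse (A x y) else Ring.inverse (A x y) * A x v)
    else
      (if v = y then -(Ring.inverse (A x y) * A u y)
       else A u v - Ring.inverse (A x y) * A u y * A x v)

/-- The minor relation `B ≼ A` on matrices over `R`: `B` is obtained from `A` by a
sequence of row/column scalings by elements of the group `G ≤ Rˣ`, deletions and
permutations of rows and columns (expressed by taking submatrices along injections),
and pivots over nonzero entries. -/
inductive IsPMinor (G : Subgroup Rˣ) :
    ∀ {X' Y' X Y : Type}, Matrix X' Y' R → Matrix X Y R → Prop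
  | refl {X Y : Type} (A : Matrix X Y R) : IsPMinor G A A
  | submatrix {X' Y' X'' Y'' X Y : Type} {B : Matrix X' Y' R} {A : Matrix X Y R}
      (f : X'' → X) (g : Y'' → Y) (hf : Function.Injective f) (hg : Function.Injective g)
      (h : IsPMinor G B (A.submatrix f g)) : IsPMinor G B A
  | scale {X' Y' X Y : Type} {B : Matrix X' Y' R} {A : Matrix X Y R}
      (u : X → Rˣ) (v : Y → Rˣ) (hu : ∀ i, u i ∈ G) (hv : ∀ j, v j ∈ G)
      (h : IsPMinor G B (Matrix.of fun i j => (u i : R) * A i j * (v j : R))) :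
      IsPMinor G B A
  | pivot {X' Y' X Y : Type} {B : Matrix X' Y' R} {A : Matrix X Y R}
      (x : X) (y : Y) (hxy : A x y ≠ 0)
      (h : IsPMinor G B (pivotMat A x y)) : IsPMinor G B A

/-- The set of cross ratios of a matrix `A`: those `p` such that `[[1,1],[p,1]]` is a
minor of `A`. -/
def crat (G : Subgroup Rˣ) {X Y : Type} (A : Matrix X Y R) : Set R :=
  {p | IsPMinor G (Matrix.of ![![1, 1], ![p, 1]]) A}

/-- `A'` is obtained from `A` by scaling rows and columns by elements of `G`. -/
def ScaleEquiv (G : Subgroup Rˣ) {X Y : Type} (A A' : Matrix X Y R) : Prop :=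
  ∃ (u : X → Rˣ) (v : Y → Rˣ), (∀ i, u i ∈ G) ∧ (∀ j, v j ∈ G) ∧
    ∀ i j, A' i j = (u i : R) * A i j * (v j : R)

/-- `A` is a *scaled `P'`-matrix* (with scalings taken from the group `G`): some
row/column scaling of `A` is a `P'`-matrix. -/
def IsScaledPMatrix (G : Subgroup Rˣ) (P' : PartialField R) {X Y : Type}
    (A : Matrix X Y R) : Prop :=
  ∃ A' : Matrix X Y R, ScaleEquiv G A A' ∧ IsPMatrix P' A'

end Matrices

/-- Let `P'` be an induced sub-partial field of `P`, and let `A` be a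
`P`-matrix all of whose entries lie in `P'`. Then `A` is a `P'`-matrix. -/
theorem pmatrix_of_entries_in_induced_sub
    {R : Type} [CommRing R] (P P' : PartialField R)
    (hind : P'.IsInducedSub P)
    {X Y : Type} (A : Matrix X Y R)
    (hA : IsPMatrix P A)
    (hent : ∀ i j, A i j ∈ P'.carrier) :
    IsPMatrix P' A := by
  obtain ⟨S, hS⟩ := hind
  intro k f g hf hg
  have hentS : ∀ i j, A i j ∈ S := by
    intro i j
    rcases hent i j with h0 | ⟨u, hu, huA⟩
    · exact h0 ▸ S.zero_mem
    · exact huA ▸ ((hS u).1 hu).2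
  rcases hA k f g hf hg with h0 | ⟨u, hu, hdet⟩
  · exact Or.inl h0
  · exact Or.inr ⟨u, (hS u).2 ⟨hu, hdet ▸
      Matrix.det_mem_of_subring S fun i j => hentS (f i) (g j)⟩, hdet⟩
end

section
/- Let A be an X×Y P-matrix over a partial field P. Then A is a scaled P[crat(A)]-matrix, that is, A can be transformed by multiplying rows and columns by elements of P∖{0} into a P[crat(A)]-matrix. -/
open scoped Classical

/-- `x` is the image in `R` of a unit lying in the subgroup `K`. -/
def UnitIn {R : Type} [CommRing R] (K : Subgroup Rˣ) (x : R) : Prop :=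
  ∃ u ∈ K, (u : R) = x

section Aux

variable {R : Type} [CommRing R] {G K : Subgroup Rˣ} {X Y : Type}

lemma UnitIn.mono (hKG : K ≤ G) {x : R} (h : UnitIn K x) : UnitIn G x := by
  obtain ⟨u, hu, rfl⟩ := h
  exact ⟨u, hKG hu, rfl⟩

lemma crat_submatrix_subset {X' Y' : Type} (A : Matrix X Y R) (f : X' → X) (g : Y' → Y)
    (hf : Function.Injective f) (hg : Function.Injective g) :
    crat G (A.submatrix f g) ⊆ crat G A :=
  fun _ h => IsPMinor.submatrix f g hf hg h

lemma crat_pivotMat_subset (A : Matrix X Y R) (x : X) (y : Y) (hxy : A x y ≠ 0) :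
    crat G (pivotMat A x y) ⊆ crat G A :=
  fun _ h => IsPMinor.pivot x y hxy h

lemma crat_scale_subset (A : Matrix X Y R) (u : X → Rˣ) (v : Y → Rˣ)
    (hu : ∀ i, u i ∈ G) (hv : ∀ j, v j ∈ G) :
    crat G (Matrix.of fun i j => (u i : R) * A i j * (v j : R)) ⊆ crat G A :=
  fun _ h => IsPMinor.scale u v hu hv h

/-- The cross ratio of a `2 × 2` submatrix with all entries in `G` is a cross ratio. -/
lemma crossRatio_mem_crat (A : Matrix X Y R) {r₀ r₁ : X} {c₀ c₁ : Y} (hr : r₀ ≠ r₁)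
    (hc : c₀ ≠ c₁) {a b c d : Rˣ} (ha : a ∈ G) (hb : b ∈ G) (hd : d ∈ G)
    (h00 : (a : R) = A r₀ c₀) (h01 : (b : R) = A r₀ c₁)
    (h10 : (c : R) = A r₁ c₀) (h11 : (d : R) = A r₁ c₁) :
    ((d⁻¹ * c * b * a⁻¹ : Rˣ) : R) ∈ crat G A := by
  have hf : Function.Injective ![r₀, r₁] := by
    intro i j; fin_cases i <;> fin_cases j <;> simp [hr, hr.symm]
  have hg : Function.Injective ![c₀, c₁] := by
    intro i j; fin_cases i <;> fin_cases j <;> simp [hc, hc.symm]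
  refine IsPMinor.submatrix ![r₀, r₁] ![c₀, c₁] hf hg ?_
  refine IsPMinor.scale ![b⁻¹, d⁻¹] ![b * a⁻¹, 1] ?_ ?_ ?_
  · intro i; fin_cases i
    · exact G.inv_mem hb
    · exact G.inv_mem hd
  · intro i; fin_cases i
    · exact G.mul_mem hb (G.inv_mem ha)
    · exact G.one_mem
  · convert IsPMinor.refl _ using 1
    ext i j
    fin_cases i <;> fin_cases j <;>
      simp [← h00, ← h01, ← h10, ← h11, mul_assoc]
    · rw [mul_left_comm (a : R)]; simp

lemma pivotMat_apply_of_ne (A : Matrix X Y R) {x u : X} {y v : Y} (hu : u ≠ x) (hv : v ≠ y) :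
    pivotMat A x y u v = A u v - Ring.inverse (A x y) * A u y * A x v := by
  simp [pivotMat, hu, hv]

/-- Along a chordless cycle of `A` consisting of a path with entries in `K` closed up by the
column `y`, the two entries in column `y` agree up to an element of `K`. -/
lemma div_mem_of_chordless [Nontrivial R] (hKG : K ≤ G) (hneg : -1 ∈ K) (n : ℕ) :
    ∀ (A : Matrix X Y R), (∀ u ∈ G, (u : R) ∈ crat G A → u ∈ K) →
    ∀ (r : ℕ → X) (c : ℕ → Y) (y : Y) (α β : Rˣ), α ∈ G → β ∈ G →
    A (r 0) y = α → A (r n) y = β →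
    (∀ k < n, UnitIn K (A (r k) (c k))) → (∀ k < n, UnitIn K (A (r (k + 1)) (c k))) →
    (∀ j ≤ n, ∀ k < n, j ≠ k → j ≠ k + 1 → A (r j) (c k) = 0) →
    (∀ k, 0 < k → k < n → A (r k) y = 0) → α * β⁻¹ ∈ K := by
  induction n with
  | zero =>
    intro A _ r c y α β _ _ h0 hn _ _ _ _
    have : α = β := Units.ext (h0.symm.trans hn)
    simp [this]
  | succ n ih =>
    intro A hA r c y α β hα hβ h0 hn hd hs hz hy
    obtain ⟨a, ha, haA⟩ := hd 0 (by omega)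
    obtain ⟨b, hb, hbA⟩ := hs 0 (by omega)
    simp only [zero_add] at hbA
    rcases Nat.eq_zero_or_pos n with rfl | hpos
    · simp only [zero_add] at hn
      by_cases hr : r 0 = r 1
      · have : α = β := Units.ext (by rw [← h0, ← hn, hr])
        simp [this]
      by_cases hc : c 0 = y
      · have h1 : α = a := Units.ext (by rw [← h0, haA, hc])
        have h2 : β = b := Units.ext (by rw [← hn, hbA, hc])
        rw [h1, h2]
        exact K.mul_mem ha (K.inv_mem hb)
      have hm := hA _ (G.mul_mem (G.mul_mem (G.mul_mem (G.inv_mem hβ) (hKG hb)) hα)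
        (G.inv_mem (hKG ha))) (crossRatio_mem_crat A hr hc (hKG ha) hα hβ haA h0.symm hbA hn.symm)
      have := K.mul_mem (K.mul_mem hm ha) (K.inv_mem hb)
      convert this using 1
      rw [eq_mul_inv_iff_mul_eq, inv_mul_cancel_right]
      ac_rfl
    · have hr : ∀ k, k < n + 1 → r (k + 1) ≠ r 0 := by
        intro k hk he
        rcases Nat.eq_zero_or_pos k with rfl | hk0
        · have := hy 1 (by omega) (by omega)
          rw [show (1 : ℕ) = 0 + 1 from rfl, he, h0] at this
          exact α.ne_zero this
        · have := hz (k + 1) (by omega) 0 (by omega) (by omega) (by omega)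
          rw [he, ← haA] at this
          exact a.ne_zero this
      have hz0 : ∀ k, k < n → A (r 0) (c (k + 1)) = 0 := fun k hk =>
        hz 0 (by omega) (k + 1) (by omega) (by omega) (by omega)
      have hc : ∀ k, k < n → c (k + 1) ≠ c 0 := by
        intro k hk he
        have := hz0 k hk
        rw [he, ← haA] at this
        exact a.ne_zero this
      have hy1 : A (r 1) y = 0 := hy 1 (by omega) (by omega)
      have hyc : y ≠ c 0 := by
        rintro rfl
        rw [← hbA] at hy1
        exact b.ne_zero hy1
      have hxy : A (r 0) (c 0) ≠ 0 := by rw [← haA]; exact a.ne_zero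
      have hkeep : ∀ j k, j < n + 1 → k < n →
          pivotMat A (r 0) (c 0) (r (j + 1)) (c (k + 1)) = A (r (j + 1)) (c (k + 1)) := by
        intro j k hj hk
        rw [pivotMat_apply_of_ne A (hr j hj) (hc k hk), hz0 k hk]
        simp
      have hkeepy : ∀ j, 0 < j → j < n + 1 →
          pivotMat A (r 0) (c 0) (r (j + 1)) y = A (r (j + 1)) y := by
        intro j hj0 hj
        rw [pivotMat_apply_of_ne A (hr j hj) hyc,
          hz (j + 1) (by omega) 0 (by omega) (by omega) (by omega)]
        simp
      have hγ : pivotMat A (r 0) (c 0) (r 1) y = ((-1 * a⁻¹ * b * α : Rˣ) : R) := by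
        rw [pivotMat_apply_of_ne A (hr 0 (by omega)) hyc, hy1, h0, ← haA, ← hbA,
          Ring.inverse_unit]
        simp
      have hK1 : -1 * a⁻¹ * b ∈ K := K.mul_mem (K.mul_mem hneg (K.inv_mem ha)) hb
      have := ih (pivotMat A (r 0) (c 0))
        (fun u hu h => hA u hu (crat_pivotMat_subset A _ _ hxy h))
        (fun k => r (k + 1)) (fun k => c (k + 1)) y (-1 * a⁻¹ * b * α) β
        (G.mul_mem (hKG hK1) hα) hβ hγ (by rw [hkeepy n hpos (by omega), hn])
        (fun k hk => by rw [hkeep k k (by omega) hk]; exact hd _ (by omega))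
        (fun k hk => by rw [hkeep (k + 1) k (by omega) hk]; exact hs _ (by omega))
        (fun j hj k hk h1 h2 => by
          rw [hkeep j k (by omega) hk]
          exact hz _ (by omega) _ (by omega) (by omega) (by omega))
        (fun k hk hkn => by rw [hkeepy k hk (by omega)]; exact hy _ (by omega) (by omega))
      rw [mul_assoc] at this
      exact (K.mul_mem_cancel_left hK1).1 this

/-- Along any closed walk of `A` consisting of a walk through columns of `T` closed up by the
column `y`, the two entries in column `y` agree up to an element of `K`, provided that all
entries in columns of `T` lie in `K ∪ {0}`. -/
lemma div_mem_of_walk [Nontrivial R] (hKG : K ≤ G) (hneg : -1 ∈ K) (A : Matrix X Y R)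
    (hA : ∀ u ∈ G, (u : R) ∈ crat G A → u ∈ K) (hAG : ∀ i j, A i j ≠ 0 → UnitIn G (A i j))
    (T : Set Y) (hT : ∀ i, ∀ j ∈ T, A i j ≠ 0 → UnitIn K (A i j)) (y : Y) (n : ℕ) :
    ∀ (r : ℕ → X) (c : ℕ → Y) (α β : Rˣ), α ∈ G → β ∈ G →
    A (r 0) y = α → A (r n) y = β → (∀ k < n, c k ∈ T) →
    (∀ k < n, A (r k) (c k) ≠ 0) → (∀ k < n, A (r (k + 1)) (c k) ≠ 0) → α * β⁻¹ ∈ K := by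
  induction n using Nat.strong_induction_on with
  | _ n ih =>
    intro r c α β hα hβ h0 hn hcT hd hs
    by_cases hchord : ∃ j ≤ n, ∃ k < n, j ≠ k ∧ j ≠ k + 1 ∧ A (r j) (c k) ≠ 0
    · obtain ⟨j, hj, k, hk, hjk, hjk1, hne⟩ := hchord
      rcases lt_or_gt_of_ne hjk with hlt | hgt
      · refine ih (n - (k - j)) (by omega) (fun i => if i ≤ j then r i else r (i + (k - j)))
          (fun i => if i < j then c i else c (i + (k - j))) α β hα hβ ?_ ?_ ?_ ?_ ?_
        · simpa using h0
        · rw [if_neg (by omega), Nat.sub_add_cancel (by omega), hn]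
        · intro i hi
          split_ifs
          · exact hcT _ (by omega)
          · exact hcT _ (by omega)
        · intro i hi
          rcases lt_trichotomy i j with h | rfl | h
          · rw [if_pos h.le, if_pos h]; exact hd _ (by omega)
          · rw [if_pos le_rfl, if_neg (lt_irrefl _), show i + (k - i) = k by omega]; exact hne
          · rw [if_neg (by omega), if_neg (by omega)]; exact hd _ (by omega)
        · intro i hi
          by_cases h : i < j
          · rw [if_pos (by omega), if_pos h]; exact hs _ (by omega)
          · rw [if_neg (by omega), if_neg h, add_right_comm]; exact hs _ (by omega)
      · refine ih (n - (j - k - 1)) (by omega)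
          (fun i => if i ≤ k then r i else r (i + (j - k - 1)))
          (fun i => if i ≤ k then c i else c (i + (j - k - 1))) α β hα hβ ?_ ?_ ?_ ?_ ?_
        · simpa using h0
        · rw [if_neg (by omega), Nat.sub_add_cancel (by omega), hn]
        · intro i hi
          split_ifs
          · exact hcT _ (by omega)
          · exact hcT _ (by omega)
        · intro i hi
          split_ifs
          · exact hd _ (by omega)
          · exact hd _ (by omega)
        · intro i hi
          rcases lt_trichotomy i k with h | rfl | h
          · rw [if_pos (by omega), if_pos h.le]; exact hs _ (by omega)
          · rw [if_neg (by omega), if_pos le_rfl, show i + 1 + (j - i - 1) = j by omega]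
            exact hne
          · rw [if_neg (by omega), if_neg (by omega), add_right_comm]; exact hs _ (by omega)
    by_cases hinner : ∃ k, 0 < k ∧ k < n ∧ A (r k) y ≠ 0
    · obtain ⟨k, hk0, hkn, hne⟩ := hinner
      obtain ⟨γ, hγ, hγA⟩ := hAG _ _ hne
      have h1 := ih k hkn r c α γ hα hγ h0 hγA.symm (fun i hi => hcT i (by omega))
        (fun i hi => hd i (by omega)) (fun i hi => hs i (by omega))
      have h2 := ih (n - k) (by omega) (fun i => r (i + k)) (fun i => c (i + k)) γ β hγ hβ
        (by simpa using hγA.symm) (by rw [Nat.sub_add_cancel hkn.le, hn])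
        (fun i hi => hcT _ (by omega))
        (fun i hi => hd _ (by omega))
        (fun i hi => by rw [add_right_comm]; exact hs _ (by omega))
      simpa [mul_assoc] using K.mul_mem h1 h2
    push Not at hchord hinner
    exact div_mem_of_chordless hKG hneg n A hA r c y α β hα hβ h0 hn
      (fun k hk => hT _ _ (hcT k hk) (hd k hk)) (fun k hk => hT _ _ (hcT k hk) (hs k hk))
      hchord hinner

/-- Two rows are adjacent through `T` if they have a common nonzero column in `T`. -/
def RowAdj (A : Matrix X Y R) (T : Set Y) (i j : X) : Prop :=
  ∃ c ∈ T, A i c ≠ 0 ∧ A j c ≠ 0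

lemma exists_walk_of_reflTransGen (A : Matrix X Y R) (T : Set Y) (y : Y) {i j : X}
    (h : Relation.ReflTransGen (RowAdj A T) i j) :
    ∃ (n : ℕ) (r : ℕ → X) (c : ℕ → Y), r 0 = i ∧ r n = j ∧ (∀ k < n, c k ∈ T) ∧
      (∀ k < n, A (r k) (c k) ≠ 0) ∧ (∀ k < n, A (r (k + 1)) (c k) ≠ 0) := by
  induction h using Relation.ReflTransGen.head_induction_on with
  | refl => exact ⟨0, fun _ => j, fun _ => y, rfl, rfl, by simp, by simp, by simp⟩
  | @head a b hab _ ih =>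
    obtain ⟨n, r, c, hr0, hrn, hc, hd, hs⟩ := ih
    obtain ⟨e, he, hea, heb⟩ := hab
    refine ⟨n + 1, fun | 0 => a | k + 1 => r k, fun | 0 => e | k + 1 => c k, rfl, hrn, ?_, ?_, ?_⟩
    · rintro (_ | k) hk
      exacts [he, hc k (by omega)]
    · rintro (_ | k) hk
      exacts [hea, hd k (by omega)]
    · rintro (_ | k) hk
      · simpa [hr0] using heb
      · exact hs k (by omega)

/-- The finite set of columns `T` can be scaled to have all entries in `K ∪ {0}`. -/
lemma exists_scaling [Nontrivial R] (hKG : K ≤ G) (hneg : -1 ∈ K) (A : Matrix X Y R)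
    (hA : ∀ u ∈ G, (u : R) ∈ crat G A → u ∈ K) (hAG : ∀ i j, A i j ≠ 0 → UnitIn G (A i j))
    (T : Finset Y) :
    ∃ (u : X → Rˣ) (v : Y → Rˣ), (∀ i, u i ∈ G) ∧ (∀ j, v j ∈ G) ∧
      ∀ i, ∀ j ∈ T, A i j ≠ 0 → UnitIn K ((u i : R) * A i j * (v j : R)) := by
  induction T using Finset.induction_on with
  | empty => exact ⟨1, 1, fun _ => G.one_mem, fun _ => G.one_mem, by simp⟩
  | insert y T hyT ih =>
    obtain ⟨u, v, hu, hv, huv⟩ := ih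
    set B : Matrix X Y R := Matrix.of fun i j => (u i : R) * A i j * (v j : R) with hB
    have hBA : ∀ i j, B i j ≠ 0 ↔ A i j ≠ 0 := by intro i j; simp [hB]
    have hBG : ∀ i j, B i j ≠ 0 → UnitIn G (B i j) := by
      intro i j h
      obtain ⟨w, hw, hwA⟩ := hAG i j ((hBA i j).1 h)
      exact ⟨u i * w * v j, G.mul_mem (G.mul_mem (hu i) hw) (hv j), by simp [hB, hwA]⟩
    have : Std.Symm (RowAdj B (T : Set Y)) := ⟨fun _ _ ⟨c, hc, h1, h2⟩ => ⟨c, hc, h2, h1⟩⟩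
    let s : Setoid X := ⟨Relation.ReflTransGen (RowAdj B (T : Set Y)),
      fun _ => .refl,
      fun h => Relation.ReflTransGen.stdSymm.symm _ _ h, fun h h' => h.trans h'⟩
    have hcomp : ∀ q : Quotient s, ∃ g ∈ G, ∀ i, Quotient.mk s i = q → B i y ≠ 0 →
        UnitIn K ((g : R) * B i y) := by
      intro q
      by_cases hq : ∃ j, Quotient.mk s j = q ∧ B j y ≠ 0
      · obtain ⟨j, rfl, hj⟩ := hq
        obtain ⟨β, hβ, hβB⟩ := hBG _ _ hj
        refine ⟨β⁻¹, G.inv_mem hβ, fun i hi hne => ?_⟩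
        obtain ⟨α, hα, hαB⟩ := hBG _ _ hne
        obtain ⟨n, r, c, hr0, hrn, hc, hd, hs⟩ :=
          exists_walk_of_reflTransGen B (T : Set Y) y (Quotient.exact hi)
        have := div_mem_of_walk hKG hneg B
          (fun u' hu' h => hA u' hu' (crat_scale_subset A u v hu hv h)) hBG (T : Set Y)
          (fun i j hj h => huv i j hj ((hBA i j).1 h)) y n r c α β hα hβ
          (by rw [hr0, hαB]) (by rw [hrn, hβB]) hc hd hs
        exact ⟨_, this, by rw [← hαB, Units.val_mul, mul_comm]⟩
      · exact ⟨1, G.one_mem, fun i hi hne => absurd ⟨i, hi, hne⟩ hq⟩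
    choose μ hμG hμ using hcomp
    have hcol : ∀ j, ∃ w ∈ G, (j ∈ T → ∀ i, B i j ≠ 0 → w = (μ (Quotient.mk s i))⁻¹) ∧
        (j ∉ T → w = 1) := by
      intro j
      by_cases hj : j ∈ T ∧ ∃ i, B i j ≠ 0
      · obtain ⟨hjT, i, hi⟩ := hj
        refine ⟨_, G.inv_mem (hμG (Quotient.mk s i)), fun _ i' hi' => ?_, fun h => absurd hjT h⟩
        rw [Quotient.sound (s := s) (Relation.ReflTransGen.single ⟨j, hjT, hi, hi'⟩)]
      · exact ⟨1, G.one_mem, fun h i hi => absurd ⟨h, i, hi⟩ hj, fun _ => rfl⟩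
    choose w hwG hwT hw1 using hcol
    refine ⟨fun i => μ (Quotient.mk s i) * u i, fun j => v j * w j,
      fun i => G.mul_mem (hμG _) (hu i), fun j => G.mul_mem (hv j) (hwG j), ?_⟩
    intro i j hj hne
    rcases Finset.mem_insert.1 hj with rfl | hjT
    · have := hμ _ i rfl ((hBA i j).2 hne)
      dsimp only
      rw [hw1 j hyT]
      simpa [hB, mul_assoc] using this
    · obtain ⟨z, hz, hzA⟩ := huv i j hjT hne
      refine ⟨z, hz, ?_⟩
      dsimp only
      rw [hwT j hjT i ((hBA i j).2 hne), hzA]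
      push_cast
      have := (μ (Quotient.mk s i)).mul_inv
      linear_combination (-(u i : R) * A i j * v j) * this

/-- Expansion of a determinant by the Schur complement of an invertible upper left entry. -/
lemma det_eq_mul_det_schur {k : ℕ} (M : Matrix (Fin (k + 1)) (Fin (k + 1)) R) (a : Rˣ)
    (ha : (a : R) = M 0 0) :
    M.det = a * (Matrix.of fun i j : Fin k =>
      M i.succ j.succ - (↑a⁻¹ : R) * M i.succ 0 * M 0 j.succ).det := by
  let N : Matrix (Fin (k + 1)) (Fin (k + 1)) R := Matrix.of fun i j =>
    Fin.cases (M 0 j) (fun i' => M i'.succ j - (↑a⁻¹ : R) * M i'.succ 0 * M 0 j) i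
  have hMN : M.det = N.det := by
    refine Matrix.det_eq_of_forall_row_eq_smul_add_const
      (fun i => Fin.cases 0 (fun i' => (↑a⁻¹ : R) * M i'.succ 0) i) 0 rfl ?_
    intro i j
    refine Fin.cases ?_ (fun i' => ?_) i <;> simp [N]
  rw [hMN, Matrix.det_succ_column_zero, Fin.sum_univ_succ, Finset.sum_eq_zero]
  · simp only [Fin.val_zero, pow_zero, one_mul, add_zero, Fin.succAbove_zero]
    congr 1
    exact ha.symm
  · intro i _
    have : N i.succ 0 = 0 := by
      simp only [N, Matrix.of_apply, Fin.cases_succ]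
      rw [← ha, mul_right_comm, Units.inv_mul, one_mul, sub_self]
    rw [this]
    simp

lemma unit_mul_mem_carrier_iff {P : PartialField R} {u : Rˣ} (hu : u ∈ P.units) {x : R} :
    (u : R) * x ∈ P.carrier ↔ x ∈ P.carrier := by
  constructor
  · rintro (h | ⟨w, hw, h⟩)
    · exact Or.inl (by simpa using h)
    · exact Or.inr ⟨u⁻¹ * w, P.units.mul_mem (P.units.inv_mem hu) hw, by simp [h]⟩
  · rintro (rfl | ⟨w, hw, rfl⟩)
    · exact Or.inl (mul_zero _)
    · exact Or.inr ⟨u * w, P.units.mul_mem hu hw, by simp⟩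

lemma IsPMatrix.submatrix {P : PartialField R} {X' Y' : Type} {A : Matrix X Y R}
    (h : IsPMatrix P A) {f : X' → X} {g : Y' → Y}
    (hf : Function.Injective f) (hg : Function.Injective g) : IsPMatrix P (A.submatrix f g) :=
  fun k f' g' hf' hg' => h k (f ∘ f') (g ∘ g') (hf.comp hf') (hg.comp hg')

lemma IsPMatrix.apply_mem {P : PartialField R} {A : Matrix X Y R}
    (h : IsPMatrix P A) (i : X) (j : Y) : A i j ∈ P.carrier := by
  simpa using h 1 (fun _ => i) (fun _ => j) (Function.injective_of_subsingleton _)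
    (Function.injective_of_subsingleton _)

lemma IsPMatrix.scale {P : PartialField R} {A : Matrix X Y R} (h : IsPMatrix P A)
    {u : X → Rˣ} {v : Y → Rˣ} (hu : ∀ i, u i ∈ P.units) (hv : ∀ j, v j ∈ P.units) :
    IsPMatrix P (Matrix.of fun i j => (u i : R) * A i j * (v j : R)) := by
  intro k f g hf hg
  have : (Matrix.of fun i j => (u i : R) * A i j * (v j : R)).submatrix f g =
      Matrix.of fun i j => (v (g j) : R) *
        (Matrix.of fun i j => (u (f i) : R) * A.submatrix f g i j) i j := by
    ext i j
    simp [mul_comm]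
  rw [this, Matrix.det_mul_row, Matrix.det_mul_column, ← Units.coe_prod, ← Units.coe_prod,
    unit_mul_mem_carrier_iff (P.units.prod_mem fun i _ => hv _),
    unit_mul_mem_carrier_iff (P.units.prod_mem fun i _ => hu _)]
  exact h k f g hf hg

lemma isPMatrix_schur {P : PartialField R} {k : ℕ} {M : Matrix (Fin (k + 1)) (Fin (k + 1)) R}
    (h : IsPMatrix P M) {a : Rˣ} (haP : a ∈ P.units) (ha : (a : R) = M 0 0) :
    IsPMatrix P (Matrix.of fun i j : Fin k =>
      M i.succ j.succ - (↑a⁻¹ : R) * M i.succ 0 * M 0 j.succ) := by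
  intro l f g hf hg
  have hinj : ∀ {f : Fin l → Fin k}, Function.Injective f →
      Function.Injective (Fin.cons 0 (Fin.succ ∘ f) : Fin (l + 1) → Fin (k + 1)) := by
    intro f hf
    rw [Fin.cons_injective_iff]
    exact ⟨by rintro ⟨x, hx⟩; exact Fin.succ_ne_zero _ hx, (Fin.succ_injective _).comp hf⟩
  have := h _ _ _ (hinj hf) (hinj hg)
  rw [det_eq_mul_det_schur _ a (by simpa using ha), unit_mul_mem_carrier_iff haP] at this
  simpa [Matrix.submatrix, Function.comp_def] using this

/-- A square `P`-matrix whose entries and cross ratios lie in `Q` has determinant in `Q`. -/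
lemma det_mem_of_entries_mem [Nontrivial R] {P Q : PartialField R} (hQP : Q.units ≤ P.units)
    (k : ℕ) : ∀ (M : Matrix (Fin k) (Fin k) R), IsPMatrix P M →
    (∀ u ∈ P.units, (u : R) ∈ crat P.units M → u ∈ Q.units) →
    (∀ i j, M i j ∈ Q.carrier) → M.det ∈ Q.carrier := by
  induction k with
  | zero =>
    intro M _ _ _
    exact Or.inr ⟨1, Q.units.one_mem, by simp⟩
  | succ k ih =>
    suffices H : ∀ (M : Matrix (Fin (k + 1)) (Fin (k + 1)) R), IsPMatrix P M →
        (∀ u ∈ P.units, (u : R) ∈ crat P.units M → u ∈ Q.units) →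
        (∀ i j, M i j ∈ Q.carrier) → M 0 0 ≠ 0 → M.det ∈ Q.carrier by
      intro M hM hcr hent
      by_cases h0 : ∃ i j, M i j ≠ 0
      · obtain ⟨i, j, hij⟩ := h0
        have hdet : (M.submatrix (Equiv.swap 0 i) (Equiv.swap 0 j)).det =
            ((Int.cast : ℤ → R) (Equiv.Perm.sign (Equiv.swap 0 i))) *
            (((Int.cast : ℤ → R) (Equiv.Perm.sign (Equiv.swap 0 j))) * M.det) := by
          rw [← Matrix.det_permute', ← Matrix.det_permute]
          rfl
        have hsign : ∀ σ : Equiv.Perm (Fin (k + 1)), ∃ s ∈ Q.units,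
            (s : R) = ((Int.cast : ℤ → R) (Equiv.Perm.sign σ)) := by
          intro σ
          rcases Int.units_eq_one_or (Equiv.Perm.sign σ) with h | h
          · exact ⟨1, Q.units.one_mem, by simp [h]⟩
          · exact ⟨-1, Q.neg_one_mem, by simp [h]⟩
        obtain ⟨s, hs, hs'⟩ := hsign (Equiv.swap 0 i)
        obtain ⟨t, ht, ht'⟩ := hsign (Equiv.swap 0 j)
        have := H (M.submatrix (Equiv.swap 0 i) (Equiv.swap 0 j))
          (hM.submatrix (Equiv.injective _) (Equiv.injective _))
          (fun u hu h => hcr u hu (crat_submatrix_subset M _ _ (Equiv.injective _)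
            (Equiv.injective _) h))
          (fun _ _ => hent _ _) (by simpa using hij)
        rwa [hdet, ← hs', ← ht', unit_mul_mem_carrier_iff hs, unit_mul_mem_carrier_iff ht] at this
      · push Not at h0
        left
        have : M = 0 := by ext i j; exact h0 i j
        rw [this, Matrix.det_zero]
    intro M hM hcr hent h00
    obtain ⟨a, ha, haM⟩ := (hent 0 0).resolve_left h00
    rw [det_eq_mul_det_schur M a haM, unit_mul_mem_carrier_iff ha]
    have hpiv := crat_pivotMat_subset (G := P.units) M 0 0 h00
    have hsch := isPMatrix_schur hM (hQP ha) haM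
    have heq : (Matrix.of fun i j : Fin k =>
        M i.succ j.succ - (↑a⁻¹ : R) * M i.succ 0 * M 0 j.succ) =
        (pivotMat M 0 0).submatrix Fin.succ Fin.succ := by
      ext i j
      rw [Matrix.submatrix_apply, pivotMat_apply_of_ne M (Fin.succ_ne_zero i)
        (Fin.succ_ne_zero j), ← haM, Ring.inverse_unit]
      rfl
    refine ih _ hsch (fun u hu h => hcr u hu (hpiv ?_)) (fun i j => ?_)
    · rw [heq] at h
      exact crat_submatrix_subset _ _ _ (Fin.succ_injective _) (Fin.succ_injective _) h
    · have hx := hsch.apply_mem i j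
      rcases hx with hx | ⟨x, hx, hxM⟩
      · exact Or.inl hx
      rcases hent i.succ 0 with hs | ⟨s, hs, hsM⟩
      · simpa [hs] using hent i.succ j.succ
      rcases hent 0 j.succ with ht | ⟨t, ht, htM⟩
      · simpa [ht] using hent i.succ j.succ
      have hmem : x⁻¹ * (-1 * a⁻¹ * s) * (a⁻¹ * t) * (a⁻¹)⁻¹ ∈ Q.units := by
        have hs' : -1 * a⁻¹ * s ∈ P.units :=
          P.units.mul_mem (P.units.mul_mem P.neg_one_mem (P.units.inv_mem (hQP ha))) (hQP hs)
        have ht' : a⁻¹ * t ∈ P.units := P.units.mul_mem (P.units.inv_mem (hQP ha)) (hQP ht)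
        have ha' := P.units.inv_mem (hQP ha)
        refine hcr _ (P.units.mul_mem (P.units.mul_mem (P.units.mul_mem (P.units.inv_mem hx)
          hs') ht') (P.units.inv_mem ha')) (hpiv ?_)
        refine crossRatio_mem_crat (pivotMat M 0 0) (Fin.succ_ne_zero i).symm
          (Fin.succ_ne_zero j).symm ha' ht' hx ?_ ?_ ?_ ?_
        · simp [pivotMat, ← haM]
        · simp [pivotMat, ← haM, ← htM]
        · simp [pivotMat, ← haM, ← hsM]
        · rw [hxM, heq]
          rfl
      have hst : -1 * a⁻¹ * s * t ∈ Q.units := Q.units.mul_mem (Q.units.mul_mem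
        (Q.units.mul_mem Q.neg_one_mem (Q.units.inv_mem ha)) hs) ht
      have hxinv : x⁻¹ * (-1 * a⁻¹ * s * t) ∈ Q.units := by
        convert hmem using 1
        rw [inv_inv, ← mul_inv_eq_iff_eq_mul]
        ac_rfl
      exact Or.inr ⟨x, Q.units.inv_mem_iff.1 ((Q.units.mul_mem_cancel_right hst).1 hxinv), hxM⟩

end Aux

/-- Every `X × Y` `P`-matrix `A` is a scaled `P[crat(A)]`-matrix: it can be
transformed, by multiplying rows and columns by elements of `P∖{0}`, into a matrix all of
whose square subdeterminants lie in the partial field generated by the cross ratios of `A`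
(together with `-1`). -/
theorem scaled_crat_matrix
    {R : Type} [CommRing R] (P : PartialField R)
    {X Y : Type} [Fintype X] [Fintype Y] (A : Matrix X Y R) (hA : IsPMatrix P A) :
    IsScaledPMatrix P.units (PartialField.ofSet (crat P.units A)) A := by
  rcases subsingleton_or_nontrivial R with _ | _
  · exact ⟨A, ⟨1, 1, fun _ => P.units.one_mem, fun _ => P.units.one_mem, by simp⟩,
      fun _ _ _ _ _ => Or.inl (Subsingleton.elim _ _)⟩
  let P' := PartialField.ofSet (crat P.units A)
  let Q : PartialField R := ⟨P'.units ⊓ P.units, P'.neg_one_mem, P.neg_one_mem⟩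
  have hQP : Q.units ≤ P.units := inf_le_right
  have hcr : ∀ u ∈ P.units, (u : R) ∈ crat P.units A → u ∈ Q.units := fun u hu h =>
    ⟨Subgroup.subset_closure (Or.inr h), hu⟩
  obtain ⟨u, v, hu, hv, huv⟩ := exists_scaling hQP Q.neg_one_mem A hcr
    (fun i j h => (hA.apply_mem i j).resolve_left h) Finset.univ
  refine ⟨_, ⟨u, v, hu, hv, fun i j => rfl⟩, fun k f g hf hg => ?_⟩
  have hdet := det_mem_of_entries_mem hQP k _ ((hA.scale hu hv).submatrix hf hg)
    (fun w hw h => hcr w hw (crat_scale_subset A u v hu hv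
      (crat_submatrix_subset _ f g hf hg h))) (fun i j => ?_)
  · exact hdet.imp id (fun h => UnitIn.mono (inf_le_left : Q.units ≤ P'.units) h)
  · by_cases h : A (f i) (g j) = 0
    · exact Or.inl (by simp [h])
    · exact Or.inr (huv _ _ (Finset.mem_univ _) h)
end
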